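/- arXiv:1612.04456 — 2 statements merged into one kernel-verified Lean document; each statement's English description precedes it below -/
import Mathlib

section
/- Let m ≥ 3 be odd, let d be a positive integer with gcd(d, 2^m − 1) = 1, and suppose F(x) = x^d is almost bent on GF(2^m). For λ ∈ GF(2^m)\{0} and t ∈ ℤ define N_{f_λ}(t) = |{(x,y) ∈ GF(2^m) × (GF(2^m)\{0,λ}) : Ŵ_{f_{λ+y}}(x) − Ŵ_{f_y}(x) = t}|, where f_μ(z) = Tr^m(μ·z^d). Then N_{f_λ}(2^{(m+3)/2}) = N_{f_λ}(−2^{(m+3)/2}) = 2^{2m−4} − 2^{m−3}, N_{f_λ}(2^{(m+1)/2}) = N_{f_λ}(−2^{(m+1)/2}) = 2^{2m−2} − 2^{m−1}, N_{f_λ}(0) = 3·2^{2m−3} + 2^{m−2} − 2^m, and N_{f_λ}(t) = 0 for every other value of t. -/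
open Finset
noncomputable section
open scoped Classical

/-- `GF n` is the finite field with `2^n` elements. -/
abbrev GF (n : ℕ) : Type := GaloisField 2 n

noncomputable instance (n : ℕ) : Fintype (GF n) := Fintype.ofFinite _

/-- The absolute trace map `GF n → 𝔽₂`. -/
def tr {n : ℕ} (x : GF n) : ZMod 2 := Algebra.trace (ZMod 2) (GF n) x

/-- The Walsh transform of an `(m,s)`-function `F` at `(α, β)`. -/
def walshF {m s : ℕ} (F : GF m → GF s) (α : GF s) (β : GF m) : ℤ :=
  ∑ x : GF m, (-1 : ℤ) ^ (tr (α * F x) + tr (β * x)).val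

/-- `N_{f_λ}(t)`: the number of pairs `(x,y)` with `y ∉ {0,λ}` such that
`Ŵ_{f_{λ+y}}(x) − Ŵ_{f_y}(x) = t`, for the power function `F(z) = z^d`. -/
def Ncount {m : ℕ} (F : GF m → GF m) (lam : GF m) (t : ℤ) : ℕ :=
  (univ.filter (fun p : GF m × GF m =>
    p.2 ≠ 0 ∧ p.2 ≠ lam ∧ walshF F (lam + p.2) p.1 - walshF F p.2 p.1 = t)).card

/-- The canonical additive character of `GF n`, with values `±1`. -/
def sgn {n : ℕ} (x : GF n) : ℤ := (-1 : ℤ) ^ (tr x).val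

theorem sgn_add {n : ℕ} (x y : GF n) : sgn (x + y) = sgn x * sgn y := by
  have h : tr (x + y) = tr x + tr y := map_add _ _ _
  have key : ∀ a b : ZMod 2, (-1 : ℤ) ^ (a + b).val = (-1) ^ a.val * (-1) ^ b.val := by decide
  rw [sgn, h, key]; rfl

theorem sgn_zero {n : ℕ} : sgn (0 : GF n) = 1 := by
  have h : tr (0 : GF n) = 0 := map_zero _
  simp [sgn, h]

theorem exists_sgn_eq_neg_one (n : ℕ) : ∃ c : GF n, sgn c = -1 := by
  obtain ⟨c, hc⟩ := Algebra.trace_surjective (ZMod 2) (GF n) 1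
  refine ⟨c, ?_⟩
  have h : tr c = 1 := hc
  rw [sgn, h]
  rfl

theorem sum_sgn_mul {n : ℕ} (a : GF n) :
    ∑ x : GF n, sgn (x * a) = if a = 0 then (Fintype.card (GF n) : ℤ) else 0 := by
  split_ifs with h
  · simp [h, sgn_zero]
  · obtain ⟨c, hc⟩ := exists_sgn_eq_neg_one n
    have h1 : ∑ x : GF n, sgn ((x + c / a) * a) = ∑ x : GF n, sgn (x * a) :=
      Fintype.sum_equiv (Equiv.addRight (c / a)) _ _ (fun _ => rfl)
    simp only [add_mul, div_mul_cancel₀ c h, sgn_add, hc] at h1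
    rw [← Finset.sum_mul] at h1
    linarith

theorem walshF_eq_sum_sgn {m s : ℕ} (F : GF m → GF s) (α : GF s) (β : GF m) :
    walshF F α β = ∑ x, sgn (α * F x) * sgn (β * x) := by
  have key : ∀ a b : ZMod 2, (-1 : ℤ) ^ (a + b).val = (-1) ^ a.val * (-1) ^ b.val := by decide
  simp only [walshF, key]; rfl

theorem GF.add_eq_zero_iff {n : ℕ} (a b : GF n) : a + b = 0 ↔ b = a := by
  rw [CharTwo.add_eq_zero, eq_comm]

theorem sum_walshF_mul {m s : ℕ} (F : GF m → GF s) (a b : GF s) :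
    ∑ x, walshF F a x * walshF F b x = Fintype.card (GF m) * ∑ z, sgn ((a + b) * F z) := by
  calc ∑ x, walshF F a x * walshF F b x
      = ∑ x, ∑ z, ∑ w, sgn (a * F z) * sgn (b * F w) * sgn (x * (z + w)) := by
        simp only [walshF_eq_sum_sgn, Finset.sum_mul_sum, mul_add, sgn_add]
        refine sum_congr rfl fun x _ => sum_congr rfl fun z _ => sum_congr rfl fun w _ => by ring
    _ = ∑ z, ∑ w, sgn (a * F z) * sgn (b * F w) * ∑ x, sgn (x * (z + w)) := by
        rw [sum_comm]
        refine sum_congr rfl fun z _ => ?_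
        rw [sum_comm]
        simp only [mul_sum]
    _ = _ := by
        simp only [sum_sgn_mul, GF.add_eq_zero_iff, mul_ite, mul_zero, sum_ite_eq', mem_univ,
          if_true, mul_sum, add_mul, sgn_add]
        refine sum_congr rfl fun z _ => by ring

theorem sum_sgn_mul_comp {m : ℕ} {F : GF m → GF m} (hF : F.Bijective) (a : GF m) :
    ∑ z, sgn (a * F z) = if a = 0 then (Fintype.card (GF m) : ℤ) else 0 := by
  rw [← sum_sgn_mul]
  exact Fintype.sum_equiv (Equiv.ofBijective F hF) _ _ fun z => by simp [mul_comm]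

theorem sum_walshF_sq {m : ℕ} {F : GF m → GF m} (hF : F.Bijective) (a : GF m) :
    ∑ x, walshF F a x ^ 2 = (Fintype.card (GF m) : ℤ) ^ 2 := by
  simp only [sq, sum_walshF_mul, sum_sgn_mul_comp hF, CharTwo.add_self_eq_zero, if_true]

theorem sum_walshF_mul_of_ne {m : ℕ} {F : GF m → GF m} (hF : F.Bijective) {a b : GF m}
    (hab : a ≠ b) : ∑ x, walshF F a x * walshF F b x = 0 := by
  rw [sum_walshF_mul, sum_sgn_mul_comp hF, if_neg, mul_zero]
  rwa [CharTwo.add_eq_zero]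

theorem sum_left_walshF_sq {m : ℕ} {F : GF m → GF m} (hF : F.Bijective) (x : GF m) :
    ∑ y, walshF F y x ^ 2 = (Fintype.card (GF m) : ℤ) ^ 2 := by
  have hinv : ∀ y, walshF F y x = walshF (Equiv.ofBijective F hF).symm x y := by
    intro y
    rw [walshF_eq_sum_sgn, walshF_eq_sum_sgn]
    exact Fintype.sum_equiv (Equiv.ofBijective F hF) _ _ fun z => by
      rw [Equiv.symm_apply_apply, Equiv.ofBijective_apply, mul_comm]
  simp only [hinv]
  exact sum_walshF_sq (Equiv.bijective _) x

theorem walshF_zero_left {m : ℕ} (F : GF m → GF m) (x : GF m) :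
    walshF F 0 x = if x = 0 then (Fintype.card (GF m) : ℤ) else 0 := by
  simp only [walshF_eq_sum_sgn, zero_mul, sgn_zero, one_mul, ← sum_sgn_mul, mul_comm x]

theorem walshF_zero_right {m : ℕ} {F : GF m → GF m} (hF : F.Bijective) {y : GF m} (hy : y ≠ 0) :
    walshF F y 0 = 0 := by
  simp only [walshF_eq_sum_sgn, zero_mul, sgn_zero, mul_one, sum_sgn_mul_comp hF, if_neg hy]

theorem walshF_zero_mul_walshF {m : ℕ} {F : GF m → GF m} (hF : F.Bijective) {y : GF m}
    (hy : y ≠ 0) (x : GF m) : walshF F 0 x * walshF F y x = 0 := by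
  rw [walshF_zero_left]
  split_ifs with h
  · rw [h, walshF_zero_right hF hy, mul_zero]
  · rw [zero_mul]

/-- The correlation of the squared Walsh spectra of components differing by `lam`. -/
def sqCorr {m : ℕ} (F : GF m → GF m) (lam : GF m) : ℤ :=
  ∑ y, ∑ x, walshF F (lam + y) x ^ 2 * walshF F y x ^ 2

theorem sum_sqCorr {m : ℕ} {F : GF m → GF m} (hF : F.Bijective) :
    ∑ lam, sqCorr F lam = (Fintype.card (GF m) : ℤ) ^ 5 := by
  have shift : ∀ y x : GF m,
      ∑ lam, walshF F (lam + y) x ^ 2 = (Fintype.card (GF m) : ℤ) ^ 2 := by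
    intro y x
    rw [← sum_left_walshF_sq hF x]
    exact Fintype.sum_equiv (Equiv.addRight y) _ _ fun _ => rfl
  calc ∑ lam, sqCorr F lam
      = ∑ y, ∑ x, (∑ lam, walshF F (lam + y) x ^ 2) * walshF F y x ^ 2 := by
        simp only [sqCorr, Finset.sum_mul]
        rw [sum_comm]
        refine sum_congr rfl fun y _ => ?_
        rw [sum_comm]
    _ = _ := by
        simp only [shift, ← mul_sum, sum_walshF_sq hF, sum_const, card_univ, nsmul_eq_mul]
        ring

theorem pow_bijective {m d : ℕ} (hm : m ≠ 0) (hd : 0 < d) (hgcd : Nat.gcd d (2 ^ m - 1) = 1) :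
    Function.Bijective (fun x : GF m => x ^ d) := by
  refine Finite.injective_iff_bijective.mp (Finite.injective_iff_surjective.mpr fun y => ?_)
  by_cases hy : y = 0
  · exact ⟨0, by simp [hy, hd.ne']⟩
  · have hc : (Nat.card (GF m)ˣ).Coprime d := by
      rw [Nat.card_units, GaloisField.card 2 m hm]
      exact Nat.Coprime.symm hgcd
    obtain ⟨u, hu⟩ := (powCoprime hc).surjective (Units.mk0 y hy)
    refine ⟨u, ?_⟩
    simpa using congrArg Units.val hu

theorem walshF_pow_mul {m d : ℕ} {c : GF m} (hc : c ≠ 0) (a b : GF m) :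
    walshF (fun x : GF m => x ^ d) (c ^ d * a) (c * b) = walshF (fun x : GF m => x ^ d) a b := by
  rw [walshF_eq_sum_sgn, walshF_eq_sum_sgn]
  refine Fintype.sum_equiv (Equiv.mulLeft₀ c hc) _ _ fun z => ?_
  simp only [Equiv.mulLeft₀_apply, mul_pow]
  congr 2 <;> ring

theorem sqCorr_pow_mul {m d : ℕ} {c : GF m} (hc : c ≠ 0) (a : GF m) :
    sqCorr (fun x : GF m => x ^ d) (c ^ d * a) = sqCorr (fun x : GF m => x ^ d) a := by
  symm
  refine Fintype.sum_equiv (Equiv.mulLeft₀ (c ^ d) (pow_ne_zero d hc)) _ _ fun y => ?_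
  refine Fintype.sum_equiv (Equiv.mulLeft₀ c hc) _ _ fun x => ?_
  simp only [Equiv.mulLeft₀_apply, ← mul_add, walshF_pow_mul hc]

theorem sqCorr_zero {m : ℕ} {F : GF m → GF m} (hF : F.Bijective)
    (hAB : ∀ y x, y ≠ 0 → walshF F y x ^ 4 = 2 * Fintype.card (GF m) * walshF F y x ^ 2) :
    sqCorr F 0 = 3 * (Fintype.card (GF m) : ℤ) ^ 4 - 2 * (Fintype.card (GF m) : ℤ) ^ 3 := by
  have h1 : ∀ y : GF m, y ≠ 0 →
      ∑ x, walshF F (0 + y) x ^ 2 * walshF F y x ^ 2 = 2 * (Fintype.card (GF m) : ℤ) ^ 3 := by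
    intro y hy
    have : ∀ x, walshF F (0 + y) x ^ 2 * walshF F y x ^ 2
        = 2 * Fintype.card (GF m) * walshF F y x ^ 2 := fun x => by
      rw [← hAB y x hy, zero_add]; ring
    simp only [this, ← mul_sum, sum_walshF_sq hF]
    ring
  rw [sqCorr, ← add_sum_erase _ _ (mem_univ (0 : GF m)),
    sum_congr rfl fun y hy => h1 y (ne_of_mem_erase hy), sum_const, card_erase_of_mem (mem_univ _),
    card_univ, nsmul_eq_mul, Nat.cast_sub Fintype.card_pos]
  simp only [add_zero, walshF_zero_left, ite_pow, mul_ite, ite_mul]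
  simp
  ring

theorem sqCorr_pow_of_ne_zero {m d : ℕ} (hF : Function.Bijective (fun x : GF m => x ^ d))
    (hAB : ∀ y x, y ≠ 0 → walshF (fun x : GF m => x ^ d) y x ^ 4
      = 2 * Fintype.card (GF m) * walshF (fun x : GF m => x ^ d) y x ^ 2)
    (hd : d ≠ 0) {lam : GF m} (hlam : lam ≠ 0) :
    sqCorr (fun x : GF m => x ^ d) lam
      = (Fintype.card (GF m) : ℤ) ^ 3 * (Fintype.card (GF m) - 2) := by
  have hconst : ∀ a : GF m, a ≠ 0 →
      sqCorr (fun x : GF m => x ^ d) a = sqCorr (fun x : GF m => x ^ d) 1 := by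
    intro a ha
    obtain ⟨c, rfl⟩ := hF.2 a
    have hc : c ≠ 0 := fun h => ha (by simp [h, hd])
    simpa using sqCorr_pow_mul (d := d) hc 1
  have hq : (1 : ℤ) < Fintype.card (GF m) := by exact_mod_cast Fintype.one_lt_card
  have hsum := sum_sqCorr hF
  rw [← add_sum_erase _ _ (mem_univ (0 : GF m)),
    sum_congr rfl fun y hy => hconst y (ne_of_mem_erase hy), sum_const,
    card_erase_of_mem (mem_univ _), card_univ, nsmul_eq_mul, Nat.cast_sub Fintype.card_pos,
    sqCorr_zero hF hAB] at hsum
  rw [hconst lam hlam]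
  have hq' : (Fintype.card (GF m) : ℤ) - 1 ≠ 0 := by linarith
  apply mul_left_cancel₀ hq'
  push_cast at hsum
  linear_combination hsum

/-- The pairs `(x, y)` with `y ∉ {0, lam}`. -/
def admissiblePairs {m : ℕ} (lam : GF m) : Finset (GF m × GF m) :=
  univ ×ˢ ((univ.erase 0).erase lam)

theorem card_admissiblePairs {m : ℕ} {lam : GF m} (hlam : lam ≠ 0) :
    ((admissiblePairs lam).card : ℤ)
      = Fintype.card (GF m) * (Fintype.card (GF m) - 2) := by
  have hq : 1 < Fintype.card (GF m) := Fintype.one_lt_card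
  rw [admissiblePairs, card_product, card_erase_of_mem (by simp [hlam]),
    card_erase_of_mem (mem_univ _), card_univ, Nat.sub_sub, Nat.cast_mul, Nat.cast_sub hq]
  rfl

theorem Ncount_eq_sum {m : ℕ} (F : GF m → GF m) (lam : GF m) (t : ℤ) :
    (Ncount F lam t : ℤ) = ∑ p ∈ admissiblePairs lam,
      if walshF F (lam + p.2) p.1 - walshF F p.2 p.1 = t then 1 else 0 := by
  rw [Ncount, sum_boole]
  congr 2
  ext p
  simp only [admissiblePairs, mem_filter, mem_product, mem_erase, mem_univ, true_and, and_true]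
  tauto

theorem Ncount_neg {m : ℕ} (F : GF m → GF m) (lam : GF m) (t : ℤ) :
    Ncount F lam (-t) = Ncount F lam t := by
  have hinv : ∀ y : GF m, lam + (lam + y) = y := fun y => by
    rw [← add_assoc, CharTwo.add_self_eq_zero, zero_add]
  have hmaps : ∀ t : ℤ, ∀ p : GF m × GF m,
      (p.2 ≠ 0 ∧ p.2 ≠ lam ∧ walshF F (lam + p.2) p.1 - walshF F p.2 p.1 = t) →
      (lam + p.2 ≠ 0 ∧ lam + p.2 ≠ lam ∧
        walshF F (lam + (lam + p.2)) p.1 - walshF F (lam + p.2) p.1 = -t) := by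
    rintro t p ⟨h0, h1, h2⟩
    refine ⟨?_, ?_, ?_⟩
    · rwa [Ne, GF.add_eq_zero_iff]
    · simpa using h0
    · rw [hinv]; linarith
  refine card_bij' (fun p _ => (p.1, lam + p.2)) (fun p _ => (p.1, lam + p.2)) ?_ ?_ ?_ ?_
  · intro p hp
    exact mem_filter.mpr ⟨mem_univ _, neg_neg t ▸ hmaps (-t) p (mem_filter.mp hp).2⟩
  · intro p hp
    exact mem_filter.mpr ⟨mem_univ _, hmaps t p (mem_filter.mp hp).2⟩
  · intro p _; simp [hinv]
  · intro p _; simp [hinv]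

theorem sum_admissiblePairs {m : ℕ} {lam : GF m} (g : GF m × GF m → ℤ) :
    ∑ p ∈ admissiblePairs lam, g p = ∑ y ∈ (univ.erase 0).erase lam, ∑ x, g (x, y) := by
  rw [admissiblePairs, sum_product_right]

section moments

variable {m : ℕ} {F : GF m → GF m} {lam : GF m}

theorem sum_admissiblePairs_sq_right (hF : F.Bijective) (hlam : lam ≠ 0) :
    ∑ p ∈ admissiblePairs lam, walshF F p.2 p.1 ^ 2
      = (Fintype.card (GF m) : ℤ) ^ 2 * (Fintype.card (GF m) - 2) := by
  have hc := card_admissiblePairs hlam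
  rw [admissiblePairs, card_product, card_univ] at hc
  push_cast at hc
  rw [sum_admissiblePairs]
  simp only [sum_walshF_sq hF, sum_const, nsmul_eq_mul]
  linear_combination (Fintype.card (GF m) : ℤ) * hc

theorem sum_admissiblePairs_sq_left (hF : F.Bijective) (hlam : lam ≠ 0) :
    ∑ p ∈ admissiblePairs lam, walshF F (lam + p.2) p.1 ^ 2
      = (Fintype.card (GF m) : ℤ) ^ 2 * (Fintype.card (GF m) - 2) := by
  have hc := card_admissiblePairs hlam
  rw [admissiblePairs, card_product, card_univ] at hc
  push_cast at hc
  rw [sum_admissiblePairs]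
  simp only [sum_walshF_sq hF, sum_const, nsmul_eq_mul]
  linear_combination (Fintype.card (GF m) : ℤ) * hc

theorem sum_admissiblePairs_mul (hF : F.Bijective) (hlam : lam ≠ 0) :
    ∑ p ∈ admissiblePairs lam, walshF F (lam + p.2) p.1 * walshF F p.2 p.1 = 0 := by
  rw [sum_admissiblePairs]
  refine sum_eq_zero fun y _ => sum_walshF_mul_of_ne hF (a := lam + y) (b := y) ?_
  simpa only [Ne, add_eq_right] using hlam

theorem sum_admissiblePairs_sq_mul_sq (hF : F.Bijective) (hlam : lam ≠ 0) :
    ∑ p ∈ admissiblePairs lam, walshF F (lam + p.2) p.1 ^ 2 * walshF F p.2 p.1 ^ 2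
      = sqCorr F lam := by
  rw [sum_admissiblePairs, sqCorr, sum_erase, sum_erase]
  · refine sum_eq_zero fun x _ => ?_
    rw [add_zero, ← mul_pow, mul_comm, walshF_zero_mul_walshF hF hlam, sq, mul_zero]
  · refine sum_eq_zero fun x _ => ?_
    rw [CharTwo.add_self_eq_zero, ← mul_pow, walshF_zero_mul_walshF hF hlam, sq, mul_zero]

end moments

theorem mul_indicators_of_sub {s A B : ℤ} (hs : 0 < s)
    (hA : A = 0 ∨ A = s ∨ A = -s) (hB : B = 0 ∨ B = s ∨ B = -s) :
    (A ^ 2 + B ^ 2 - 2 * (A * B) = s ^ 2 * ((if A - B = s then 1 else 0)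
      + (if A - B = -s then 1 else 0) + 4 * (if A - B = 2 * s then 1 else 0)
      + 4 * (if A - B = -(2 * s) then 1 else 0))) ∧
    (s ^ 2 * (A ^ 2 + B ^ 2) - 8 * s ^ 2 * (A * B) + 6 * (A ^ 2 * B ^ 2)
      = s ^ 4 * ((if A - B = s then 1 else 0)
      + (if A - B = -s then 1 else 0) + 16 * (if A - B = 2 * s then 1 else 0)
      + 16 * (if A - B = -(2 * s) then 1 else 0))) ∧
    (1 : ℤ) = (if A - B = 0 then 1 else 0) + (if A - B = s then 1 else 0)
      + (if A - B = -s then 1 else 0) + (if A - B = 2 * s then 1 else 0)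
      + (if A - B = -(2 * s) then 1 else 0) := by
  have key : ∀ a b : ℤ, (if a * s = b * s then (1 : ℤ) else 0) = if a = b then 1 else 0 :=
    fun a b => by simp [hs.ne']
  have hA' : ∃ a : ℤ, A = a * s ∧ (a = 0 ∨ a = 1 ∨ a = -1) := by
    rcases hA with h | h | h
    · exact ⟨0, by simp [h]⟩
    · exact ⟨1, by simp [h]⟩
    · exact ⟨-1, by simp [h]⟩
  have hB' : ∃ a : ℤ, B = a * s ∧ (a = 0 ∨ a = 1 ∨ a = -1) := by
    rcases hB with h | h | h
    · exact ⟨0, by simp [h]⟩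
    · exact ⟨1, by simp [h]⟩
    · exact ⟨-1, by simp [h]⟩
  obtain ⟨a, rfl, ha⟩ := hA'
  obtain ⟨b, rfl, hb⟩ := hB'
  have k0 := key (a - b) 0
  have k1 := key (a - b) 1
  have k2 := key (a - b) (-1)
  have k3 := key (a - b) 2
  have k4 := key (a - b) (-2)
  rw [sub_mul] at k0 k1 k2 k3 k4
  rw [zero_mul] at k0
  rw [one_mul] at k1
  rw [neg_mul, one_mul] at k2
  rw [neg_mul] at k4
  rw [k0, k1, k2, k3, k4]
  rcases ha with rfl | rfl | rfl <;> rcases hb with rfl | rfl | rfl <;> norm_num <;> ring_nf <;> simp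

/-- the distribution of the differences of Walsh transforms of the
component functions of an almost bent power function `F(x) = x^d` on `GF(2^m)`,
`m = 2k+1 ≥ 3` odd. -/
theorem stmt5 (m k d : ℕ) (hm : m = 2 * k + 1) (hm3 : 3 ≤ m)
    (hd : 0 < d) (hgcd : Nat.gcd d (2 ^ m - 1) = 1)
    (F : GF m → GF m) (hF : ∀ x : GF m, F x = x ^ d)
    (hAB : ∀ μ : GF m, μ ≠ 0 → ∀ a : GF m,
      walshF F μ a ∈ ({0, 2 ^ (k + 1), -(2 ^ (k + 1))} : Set ℤ))
    (lam : GF m) (hlam : lam ≠ 0) :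
    Ncount F lam (2 ^ (k + 2)) = 2 ^ (2 * m - 4) - 2 ^ (m - 3) ∧
    Ncount F lam (-(2 ^ (k + 2))) = 2 ^ (2 * m - 4) - 2 ^ (m - 3) ∧
    Ncount F lam (2 ^ (k + 1)) = 2 ^ (2 * m - 2) - 2 ^ (m - 1) ∧
    Ncount F lam (-(2 ^ (k + 1))) = 2 ^ (2 * m - 2) - 2 ^ (m - 1) ∧
    (Ncount F lam 0 : ℤ) = 3 * 2 ^ (2 * m - 3) + 2 ^ (m - 2) - 2 ^ m ∧
    ∀ t : ℤ, t ∉ ({0, 2 ^ (k + 1), -(2 ^ (k + 1)), 2 ^ (k + 2), -(2 ^ (k + 2))} : Set ℤ) →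
      Ncount F lam t = 0 := by
  obtain rfl : F = fun x => x ^ d := funext hF
  have hbij := pow_bijective (by omega : m ≠ 0) hd hgcd
  set F : GF m → GF m := fun x => x ^ d with hFdef
  have hcard : Fintype.card (GF m) = 2 ^ m := by
    rw [← Nat.card_eq_fintype_card, GaloisField.card 2 m (by omega)]
  obtain ⟨j, rfl⟩ : ∃ j, k = j + 1 := ⟨k - 1, by omega⟩
  set u : ℤ := 2 ^ j with hu
  have hu0 : 0 < u := by positivity
  have hq : (Fintype.card (GF m) : ℤ) = 8 * u ^ 2 := by
    rw [hcard, hm, hu]; push_cast; ring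
  set s : ℤ := 2 ^ (j + 1 + 1) with hs
  have hsu : s = 4 * u := by rw [hs, hu]; ring
  have hs0 : 0 < s := by positivity
  have hval : ∀ y : GF m, y ≠ 0 → ∀ x, walshF F y x = 0 ∨ walshF F y x = s ∨ walshF F y x = -s :=
    fun y hy x => by simpa using hAB y hy x
  have hs2 : (2 : ℤ) ^ (j + 1 + 2) = 2 * s := by rw [hs]; ring
  have hfour : ∀ y x, y ≠ 0 → walshF F y x ^ 4 = 2 * Fintype.card (GF m) * walshF F y x ^ 2 := by
    intro y x hy
    rw [hq]
    rcases hval y hy x with h | h | h <;> rw [h] <;> try rw [hsu]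
    all_goals ring
  have hcorr : sqCorr F lam
      = (Fintype.card (GF m) : ℤ) ^ 3 * (Fintype.card (GF m) - 2) :=
    sqCorr_pow_of_ne_zero hbij hfour hd.ne' hlam
  have hmem : ∀ p ∈ admissiblePairs lam, p.2 ≠ 0 ∧ lam + p.2 ≠ 0 := by
    intro p hp
    simp only [admissiblePairs, mem_product, mem_erase, mem_univ, true_and, and_true] at hp
    exact ⟨hp.2, by rw [Ne, GF.add_eq_zero_iff]; exact hp.1⟩
  have hind := fun p hp => mul_indicators_of_sub hs0 (hval _ (hmem p hp).2 p.1)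
    (hval _ (hmem p hp).1 p.1)
  have e1 := sum_congr rfl fun p hp => (hind p hp).1
  have e2 := sum_congr rfl fun p hp => (hind p hp).2.1
  have e3 := sum_congr rfl fun p hp => (hind p hp).2.2
  simp only [sum_add_distrib, sum_sub_distrib, ← mul_sum, ← Ncount_eq_sum, Ncount_neg,
    sum_admissiblePairs_sq_left hbij hlam, sum_admissiblePairs_sq_right hbij hlam,
    sum_admissiblePairs_mul hbij hlam, sum_admissiblePairs_sq_mul_sq hbij hlam, hcorr] at e1 e2 e3
  rw [sum_const, nsmul_eq_mul, card_admissiblePairs hlam] at e3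
  rw [hq, hsu] at e1 e2 e3
  rw [hs2, hsu, Ncount_neg, Ncount_neg]
  have f1 : 2 * (Ncount F lam (4 * u) : ℤ) + 8 * Ncount F lam (2 * (4 * u))
      = 8 * u ^ 2 * (8 * u ^ 2 - 2) := by
    apply mul_left_cancel₀ (pow_ne_zero 2 hu0.ne')
    linarith
  have f2 : 2 * (Ncount F lam (4 * u) : ℤ) + 32 * Ncount F lam (2 * (4 * u))
      = 20 * u ^ 2 * (8 * u ^ 2 - 2) := by
    apply mul_left_cancel₀ (pow_ne_zero 4 hu0.ne')
    linarith
  have g2 : (Ncount F lam (2 * (4 * u)) : ℤ) = 4 * u ^ 4 - u ^ 2 := by linarith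
  have g1 : (Ncount F lam (4 * u) : ℤ) = 16 * u ^ 4 - 4 * u ^ 2 := by linarith
  have p1 : Ncount F lam (2 * (4 * u)) = 2 ^ (2 * m - 4) - 2 ^ (m - 3) := by
    zify [Nat.pow_le_pow_right (show 0 < 2 by norm_num) (show m - 3 ≤ 2 * m - 4 by omega)]
    rw [g2, show 2 * m - 4 = j * 4 + 2 by omega, show m - 3 = j * 2 by omega, hu]
    ring
  have p2 : Ncount F lam (4 * u) = 2 ^ (2 * m - 2) - 2 ^ (m - 1) := by
    zify [Nat.pow_le_pow_right (show 0 < 2 by norm_num) (show m - 1 ≤ 2 * m - 2 by omega)]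
    rw [g1, show 2 * m - 2 = j * 4 + 4 by omega, show m - 1 = j * 2 + 2 by omega, hu]
    ring
  refine ⟨p1, p1, p2, p2, ?_, ?_⟩
  · have p0 : (Ncount F lam 0 : ℤ) = 24 * u ^ 4 - 6 * u ^ 2 := by linarith
    have hqm : (2 : ℤ) ^ m = 8 * u ^ 2 := by rw [← hq, hcard]; norm_cast
    rw [p0, hqm, show 2 * m - 3 = j * 4 + 3 by omega, show m - 2 = j * 2 + 1 by omega, hu]
    ring
  · intro t ht
    rw [Ncount, card_eq_zero, filter_eq_empty_iff]
    rintro p - ⟨h0, h1, rfl⟩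
    apply ht
    have hA := hval (lam + p.2) (by rwa [Ne, GF.add_eq_zero_iff]) p.1
    have hB := hval p.2 h0 p.1
    rw [hsu] at hA hB
    simp only [Set.mem_insert_iff, Set.mem_singleton_iff]
    rcases hA with hA | hA | hA <;> rcases hB with hB | hB | hB <;> rw [hA, hB] <;> omega
end
end

section
/- Let F be an (m,s)-function, let λ ∈ GF(2^s)\{0}, and let H_λ be an 𝔽_2-linear subspace of GF(2^s) of dimension s−1 with λ ∉ H_λ. If 2^m − 2·nl(F) < n_{f_λ}, then the subcode C_{D_{f_λ},H_λ} = {c_{x,y} : x ∈ GF(2^m), y ∈ H_λ} has length n_{f_λ}, the map (x,y) ↦ c_{x,y} from GF(2^m) × H_λ to 𝔽_2^{D_{f_λ}} is injective (so C_{D_{f_λ},H_λ} is an 𝔽_2-linear code of dimension m+s−1), and every nonzero codeword has Hamming weight at least nl(F) − (2^m − n_{f_λ})/2. -/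
open Finset
noncomputable section
open scoped Classical

/-- `max_{(α,β), α ≠ 0} |Ŵ_F(α,β)|`. -/
def maxW {m s : ℕ} (F : GF m → GF s) : ℕ :=
  Finset.sup (univ.filter (fun p : GF s × GF m => p.1 ≠ 0))
    (fun p => (walshF F p.1 p.2).natAbs)

/-- The nonlinearity `nl(F) = 2^(m-1) - (1/2)·max |Ŵ_F|`, as a rational number. -/
def nlF {m s : ℕ} (F : GF m → GF s) : ℚ := (2:ℚ)^m / 2 - (maxW F : ℚ) / 2

/-- The support `D_{f_λ}` of the component function `f_λ = Tr(λ·F)`. -/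
abbrev Dsupp {m s : ℕ} (F : GF m → GF s) (lam : GF s) : Type :=
  {d : GF m // tr (lam * F d) = 1}

/-- `n_{f_λ}`, the cardinality of the support of `f_λ`. -/
def nSupp {m s : ℕ} (F : GF m → GF s) (lam : GF s) : ℕ := Fintype.card (Dsupp F lam)

/-- The codeword `c_{x,y} = (Tr(x·d) + Tr(y·F(d)))_{d ∈ D_{f_λ}}`. -/
def cw {m s : ℕ} (F : GF m → GF s) (lam : GF s) (x : GF m) (y : GF s) :
    Dsupp F lam → ZMod 2 :=
  fun d => tr (x * d.1) + tr (y * F d.1)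

/-- Hamming weight of the codeword `c_{x,y}`. -/
def wtc {m s : ℕ} (F : GF m → GF s) (lam : GF s) (x : GF m) (y : GF s) : ℕ :=
  (univ.filter (fun d : Dsupp F lam => cw F lam x y d ≠ 0)).card


/-- The sign `(-1)^a` attached to `a : 𝔽₂`. -/
def binSign (a : ZMod 2) : ℤ := (-1) ^ a.val

lemma binSign_add (a b : ZMod 2) : binSign (a + b) = binSign a * binSign b := by
  unfold binSign; revert a b; decide

lemma binSign_one : binSign 1 = -1 := rfl

lemma binSign_eq_ite (a : ZMod 2) : binSign a = 1 - 2 * if a ≠ 0 then 1 else 0 := by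
  unfold binSign; revert a; decide

lemma one_sub_binSign (a : ZMod 2) : 1 - binSign a = if a = 1 then 2 else 0 := by
  unfold binSign; revert a; decide

lemma tr_add {n : ℕ} (x y : GF n) : tr (x + y) = tr x + tr y := map_add _ x y

lemma tr_zero {n : ℕ} : tr (0 : GF n) = 0 := map_zero _

lemma exists_tr_mul_eq_one {n : ℕ} {x : GF n} (hx : x ≠ 0) : ∃ z, tr (x * z) = 1 := by
  obtain ⟨w, hw⟩ := Algebra.trace_surjective (ZMod 2) (GF n) 1
  exact ⟨x⁻¹ * w, by rw [mul_inv_cancel_left₀ hx]; exact hw⟩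

lemma walshF_eq_sum {m s : ℕ} (F : GF m → GF s) (α : GF s) (β : GF m) :
    walshF F α β = ∑ x, binSign (tr (α * F x) + tr (β * x)) := rfl

lemma walshF_zero_left_s7 {m s : ℕ} (F : GF m → GF s) {β : GF m} (hβ : β ≠ 0) :
    walshF F 0 β = 0 := by
  obtain ⟨z, hz⟩ := exists_tr_mul_eq_one hβ
  have key : walshF F 0 β = -walshF F 0 β := by
    simp only [walshF_eq_sum, zero_mul, tr_zero, zero_add]
    rw [← Finset.sum_neg_distrib, ← Equiv.sum_comp (Equiv.addRight z)]
    refine Finset.sum_congr rfl fun x _ => ?_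
    rw [Equiv.coe_addRight, mul_add, tr_add, hz, binSign_add, binSign_one, mul_neg_one]
  omega

lemma natAbs_walshF_le {m s : ℕ} (F : GF m → GF s) {α : GF s} (hα : α ≠ 0) (β : GF m) :
    (walshF F α β).natAbs ≤ maxW F :=
  Finset.le_sup (f := fun p : GF s × GF m => (walshF F p.1 p.2).natAbs)
    (b := (α, β)) (by simpa using hα)

/-- The character sum over the support of `f_λ` is a difference of Walsh coefficients. -/
lemma two_mul_nSupp_sub_wtc {m s : ℕ} (F : GF m → GF s) (lam : GF s) (x : GF m) (y : GF s) :
    2 * ((nSupp F lam : ℤ) - 2 * wtc F lam x y) = walshF F y x - walshF F (y + lam) x := by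
  have hleft : (nSupp F lam : ℤ) - 2 * wtc F lam x y = ∑ d, binSign (cw F lam x y d) := by
    simp only [binSign_eq_ite, Finset.sum_sub_distrib, ← Finset.mul_sum, Finset.sum_boole,
      wtc, nSupp]
    simp
  have hsub : ∑ d, binSign (cw F lam x y d) =
      ∑ d with tr (lam * F d) = 1, binSign (tr (x * d) + tr (y * F d)) :=
    (Finset.sum_subtype _ (by simp) fun d => binSign (tr (x * d) + tr (y * F d))).symm
  rw [hleft, hsub, walshF_eq_sum, walshF_eq_sum, ← Finset.sum_sub_distrib, Finset.mul_sum,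
    Finset.sum_filter]
  refine Finset.sum_congr rfl fun d _ => ?_
  have h := one_sub_binSign (tr (lam * F d))
  rw [add_mul, tr_add, binSign_add, binSign_add, binSign_add, binSign_add]
  split_ifs at h ⊢ <;>
    linear_combination (-(binSign (tr (x * d)) * binSign (tr (y * F d)))) * h

lemma nSupp_le_two_mul_wtc_add_maxW {m s : ℕ} (F : GF m → GF s) {lam : GF s} {x : GF m}
    {y : GF s} (hy : y + lam ≠ 0) (hxy : x ≠ 0 ∨ y ≠ 0) :
    nSupp F lam ≤ 2 * wtc F lam x y + maxW F := by
  have hsum := two_mul_nSupp_sub_wtc F lam x y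
  have h₁ := natAbs_walshF_le F hy x
  have h₂ : (walshF F y x).natAbs ≤ maxW F := by
    by_cases h : y = 0
    · rw [h, walshF_zero_left_s7 F (hxy.resolve_right (not_not_intro h))]
      exact Nat.zero_le _
    · exact natAbs_walshF_le F h x
  omega

lemma cw_sub {m s : ℕ} (F : GF m → GF s) (lam : GF s) (x x' : GF m) (y y' : GF s) :
    cw F lam (x - x') (y - y') = cw F lam x y - cw F lam x' y' := by
  funext d
  simp only [cw, Pi.sub_apply, sub_mul, tr, map_sub]
  ring

lemma cw_zero {m s : ℕ} (F : GF m → GF s) (lam : GF s) : cw F lam 0 0 = 0 := by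
  funext d
  simp [cw, tr_zero]

/-- the subcode `C_{D_{f_λ},H_λ}` obtained by restricting `y` to an
`𝔽₂`-hyperplane `H_λ` of `GF(2^s)` not containing `λ`: it has length `n_{f_λ}`, the map
`(x,y) ↦ c_{x,y}` is injective on `GF(2^m) × H_λ` (so the subcode has dimension
`m+s-1`), and every nonzero codeword has weight at least `nl(F) - (2^m - n_{f_λ})/2`. -/
theorem stmt7 (m s : ℕ) (hm : 1 ≤ m) (hs : 1 ≤ s)
    (F : GF m → GF s) (lam : GF s) (hlam : lam ≠ 0)
    (H : Submodule (ZMod 2) (GF s))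
    (hH : Module.finrank (ZMod 2) H = s - 1) (hlamH : lam ∉ H)
    (hcond : (2:ℚ)^m - 2 * nlF F < (nSupp F lam : ℚ)) :
    Function.Injective (fun p : GF m × H => cw F lam p.1 p.2.1) ∧
    ∀ x : GF m, ∀ y ∈ H, cw F lam x y ≠ 0 →
      nlF F - ((2:ℚ)^m - (nSupp F lam : ℚ)) / 2 ≤ (wtc F lam x y : ℚ) := by
  have hadd : ∀ y ∈ H, y + lam ≠ 0 := fun y hy h =>
    hlamH (by rw [← neg_eq_of_add_eq_zero_right h]; exact H.neg_mem hy)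
  have hmax : maxW F < nSupp F lam := by
    have : (maxW F : ℚ) < nSupp F lam := by
      unfold nlF at hcond
      linarith
    exact_mod_cast this
  refine ⟨?_, fun x y hy hne => ?_⟩
  · rintro ⟨x, y⟩ ⟨x', y'⟩ h
    by_contra hne
    have hxy : x - x' ≠ 0 ∨ (y : GF s) - y' ≠ 0 := by
      by_contra! h'
      exact hne (Prod.ext (sub_eq_zero.mp h'.1) (Subtype.ext (sub_eq_zero.mp h'.2)))
    have hle := nSupp_le_two_mul_wtc_add_maxW F (hadd _ (H.sub_mem y.2 y'.2)) hxy
    have hwt : wtc F lam (x - x') (y - y') = 0 := by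
      have hzero : cw F lam (x - x') (y - y') = 0 := by
        rw [cw_sub]
        exact sub_eq_zero.mpr h
      simp [wtc, hzero]
    omega
  · have hxy : x ≠ 0 ∨ y ≠ 0 := by
      by_contra! h
      exact hne (by rw [h.1, h.2, cw_zero])
    have hle : (nSupp F lam : ℚ) ≤ 2 * wtc F lam x y + maxW F := by
      exact_mod_cast nSupp_le_two_mul_wtc_add_maxW F (hadd y hy) hxy
    unfold nlF
    linarith
end
end
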